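/- Let α > 1/2. Define x_0 := 1 and, for k ≥ 1, x_j := 2^{−kα} for all j with 2^{k−1} ≤ j ≤ 2^{k} − 1; let F := {x_j e_j : j ≥ 0} ∪ {0} ⊂ ℓ∞(ℕ). Then for every n ≥ 1 the greedy errors satisfy σ_n(F) = x_n ≥ (2n)^{−α}, while there exists a constant C depending only on α such that the Kolmogorov widths satisfy d_n(F)_{ℓ∞} ≤ C · n^{−α−1/2} for all n ≥ 1. In particular, the factor √n in the Banach-space bound σ_{2ℓ} ≤ 2γ^{−1}√(ℓ d_ℓ) cannot in general be removed. -/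

import Mathlib

open Metric Submodule ENNReal

/-- Over the field with `q` elements, `q` prime, there is a family of `q ^ d` polynomials of degree
less than `d`, any two of which agree in fewer than `d` points. -/
theorem exists_polynomial_family (q d : ℕ) [Fact q.Prime] :
    ∃ P : ℕ → Polynomial (ZMod q), ∀ i < q ^ d, ∀ j < q ^ d, i ≠ j →
      (Finset.univ.filter fun a => (P i).eval a = (P j).eval a).card < d := by
  have hcard : Fintype.card (Fin d → ZMod q) = q ^ d := by simp [ZMod.card]
  let e : Polynomial.degreeLT (ZMod q) d ≃ Fin (q ^ d) :=
    (Polynomial.degreeLTEquiv (ZMod q) d).toEquiv.trans (Fintype.equivFinOfCardEq hcard)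
  refine ⟨fun i => if h : i < q ^ d then (e.symm ⟨i, h⟩ : Polynomial (ZMod q)) else 0,
    fun i hi j hj hij => ?_⟩
  simp only [hi, hj, dif_pos]
  by_contra! hd
  have hdeg (k : Fin (q ^ d)) {s : Finset (ZMod q)} (hs : d ≤ s.card) :
      (e.symm k : Polynomial (ZMod q)).degree < s.card :=
    (Polynomial.mem_degreeLT.1 (e.symm k).2).trans_le (by exact_mod_cast hs)
  have heq := Polynomial.eq_of_degrees_lt_of_eval_finset_eq _ (hdeg ⟨i, hi⟩ hd) (hdeg ⟨j, hj⟩ hd)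
    fun a ha => (Finset.mem_filter.1 ha).2
  exact hij (by simpa using e.symm.injective (Subtype.ext heq))

/-- The indicator function of a set of natural numbers, as a bounded sequence. -/
noncomputable def indicatorSeq (s : Set ℕ) : lp (fun _ : ℕ => ℝ) ∞ :=
  ⟨s.indicator 1, memℓp_infty ⟨1, by
    rintro _ ⟨i, rfl⟩
    simpa using norm_indicator_le_norm_self (s := s) (f := (1 : ℕ → ℝ)) (a := i)⟩⟩

open Classical in
theorem indicatorSeq_apply (s : Set ℕ) (i : ℕ) : indicatorSeq s i = if i ∈ s then 1 else 0 :=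
  Set.indicator_apply _ _ _

/-- A space of dimension at most `q ^ 2` approximates the first `q ^ d` unit vectors of `ℓ∞`
up to an error `d / q`. -/
theorem exists_subspace_approx_single (q d : ℕ) [Fact q.Prime] :
    ∃ Y : Submodule ℝ (lp (fun _ : ℕ => ℝ) ∞), FiniteDimensional ℝ Y ∧
      Module.finrank ℝ Y ≤ q ^ 2 ∧
      ∀ j < q ^ d, ∃ y ∈ Y, ‖lp.single ∞ j (1 : ℝ) - y‖ ≤ d / q := by
  classical
  obtain ⟨P, hP⟩ := exists_polynomial_family q d
  have hq : (0 : ℝ) < q := by exact_mod_cast (Fact.out : q.Prime).pos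
  let u (c : ZMod q × ZMod q) := indicatorSeq {i | i < q ^ d ∧ (P i).eval c.1 = c.2}
  refine ⟨span ℝ (Set.range u), FiniteDimensional.span_of_finite ℝ (Set.finite_range u), ?_,
    fun j hj => ⟨(q : ℝ)⁻¹ • ∑ a, u (a, (P j).eval a),
      smul_mem _ _ (sum_mem fun a _ => subset_span ⟨_, rfl⟩), ?_⟩⟩
  · refine (finrank_range_le_card u).trans_eq ?_
    rw [Fintype.card_prod, ZMod.card, sq]
  refine lp.norm_le_of_forall_le (by positivity) fun i => ?_
  have hval : ((q : ℝ)⁻¹ • ∑ a, u (a, (P j).eval a)) i = if i < q ^ d then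
      (q : ℝ)⁻¹ * (Finset.univ.filter fun a => (P i).eval a = (P j).eval a).card else 0 := by
    rw [lp.coeFn_smul, Pi.smul_apply, lp.coeFn_sum, Finset.sum_apply]
    simp only [u, indicatorSeq_apply, Set.mem_ofPred_eq, smul_eq_mul]
    split_ifs with h <;> simp [h]
  rw [lp.coeFn_sub, Pi.sub_apply, hval]
  by_cases hij : i = j
  · subst hij
    rw [lp.single_apply_self, if_pos hj]
    simp only [Finset.filter_true, Finset.card_univ, ZMod.card, inv_mul_cancel₀ hq.ne', sub_self,
      norm_zero]
    positivity
  · rw [lp.single_apply_ne _ _ _ hij, zero_sub, norm_neg]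
    split_ifs with h
    · rw [Real.norm_of_nonneg (by positivity), inv_mul_eq_div]
      gcongr
      exact (hP i h j hj hij).le
    · rw [norm_zero]
      positivity

/-- For every `n ≥ 8` there is a prime whose square is comparable with `n`. -/
theorem exists_prime_sq_comparable {n : ℕ} (hn : 8 ≤ n) :
    ∃ q : ℕ, q.Prime ∧ 2 * q ^ 2 ≤ n ∧ n ≤ 8 * q ^ 2 := by
  have h1 : 1 ≤ n / 8 := by omega
  have hs : 1 ≤ Nat.sqrt (n / 8) := Nat.le_sqrt.2 (by simpa using h1)
  obtain ⟨q, hq, hlt, hle⟩ := Nat.exists_prime_lt_and_le_two_mul _ (by omega : Nat.sqrt (n / 8) ≠ 0)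
  refine ⟨q, hq, ?_, ?_⟩
  · have := Nat.sqrt_le (n / 8)
    have h2 : 8 * (n / 8) ≤ n := Nat.mul_div_le _ _
    nlinarith
  · have := Nat.sqrt_lt.1 hlt
    rw [sq]
    omega

theorem dyadic_eq {α : ℝ} {x : ℕ → ℝ}
    (hxk : ∀ k : ℕ, 1 ≤ k → ∀ j : ℕ, 2 ^ (k - 1) ≤ j → j ≤ 2 ^ k - 1 →
    x j = (2 : ℝ) ^ (-(k : ℝ) * α)) {j : ℕ} (hj : 1 ≤ j) :
    x j = ((2 ^ (Nat.log 2 j + 1) : ℕ) : ℝ) ^ (-α) := by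
  have hlt := Nat.lt_pow_succ_log_self one_lt_two j
  rw [hxk (Nat.log 2 j + 1) (by omega) j (Nat.pow_log_le_self 2 (by omega))
    (Nat.le_sub_one_of_lt hlt), Nat.cast_pow, ← Real.rpow_natCast, Nat.cast_ofNat,
    ← Real.rpow_mul zero_le_two, neg_mul, mul_neg]

theorem rpow_neg_anti {α : ℝ} (hα : 0 ≤ α) {a b : ℕ} (ha : 1 ≤ a) (hab : a ≤ b) :
    (b : ℝ) ^ (-α) ≤ (a : ℝ) ^ (-α) :=
  Real.rpow_le_rpow_of_nonpos (by exact_mod_cast ha) (by exact_mod_cast hab) (by linarith)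

/-- For sequences with `x j ≤ j ^ (-α)`, a space of dimension at most `n` approximates all the
`x j • e_j` up to a multiple of `n ^ (-α - 1 / 2)`. -/
theorem exists_subspace_approx {α : ℝ} (hα : 1 / 2 < α) {x : ℕ → ℝ} (hx0 : x 0 = 1)
    (hx : ∀ j, 0 ≤ x j) (hxle : ∀ j : ℕ, 1 ≤ j → x j ≤ (j : ℝ) ^ (-α)) {n : ℕ} (hn : 1 ≤ n) :
    ∃ Y : Submodule ℝ (lp (fun _ : ℕ => ℝ) ∞), FiniteDimensional ℝ Y ∧ Module.finrank ℝ Y ≤ n ∧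
      ∀ j, ∃ y ∈ Y, ‖x j • lp.single ∞ j (1 : ℝ) - y‖ ≤
        4 * 8 ^ (α + 1 / 2) * (n : ℝ) ^ (-α - 1 / 2) := by
  have hnorm (j : ℕ) : ‖x j • (lp.single ∞ j (1 : ℝ) : lp (fun _ : ℕ => ℝ) ∞)‖ = x j := by
    rw [norm_smul, lp.norm_single (by simp), norm_one, mul_one, Real.norm_of_nonneg (hx j)]
  have hn0 : (0 : ℝ) < n := by exact_mod_cast hn
  -- The bound, in terms of any `t` comparable with `n`.
  have hcomp {t : ℝ} (ht : 0 < t) (htn : n ≤ 8 * t) :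
      t ^ (-α - 1 / 2) ≤ 8 ^ (α + 1 / 2) * (n : ℝ) ^ (-α - 1 / 2) := by
    have h := Real.rpow_le_rpow_of_nonpos hn0 htn (by linarith : -α - 1 / 2 ≤ 0)
    rw [Real.mul_rpow (by norm_num) ht.le] at h
    calc t ^ (-α - 1 / 2)
        = 8 ^ (α + 1 / 2) * ((8 : ℝ) ^ (-α - 1 / 2) * t ^ (-α - 1 / 2)) := by
          rw [← mul_assoc, ← Real.rpow_add (by norm_num)]
          ring_nf
          simp
      _ ≤ _ := by gcongr
  rcases lt_or_ge n 8 with hn8 | hn8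
  · refine ⟨⊥, inferInstance, by simp, fun j => ⟨0, zero_mem _, ?_⟩⟩
    rw [sub_zero, hnorm]
    have h1 := hcomp one_pos (by rw [mul_one]; exact_mod_cast hn8.le)
    rw [Real.one_rpow] at h1
    have hx1 : x j ≤ 1 := by
      rcases Nat.eq_zero_or_pos j with rfl | hj
      · exact hx0.le
      · simpa using (hxle j hj).trans (rpow_neg_anti (by linarith) le_rfl hj)
    linarith
  obtain ⟨q, hq, hqn, hnq⟩ := exists_prime_sq_comparable hn8
  have : Fact q.Prime := ⟨hq⟩
  have hq1 : (1 : ℝ) ≤ q := by exact_mod_cast hq.one_le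
  have hq0 : (0 : ℝ) < q := by linarith
  have hB := hcomp (t := (q : ℝ) ^ 2) (by positivity) (by exact_mod_cast hnq)
  have hqpow (k : ℕ) (r : ℝ) : ((q : ℝ) ^ k) ^ r = (q : ℝ) ^ (k * r) := by
    rw [← Real.rpow_natCast, ← Real.rpow_mul hq0.le]
  rw [hqpow] at hB
  obtain ⟨Y, hY, hYrank, hYapp⟩ := exists_subspace_approx_single q 4
  let e (i : Fin (q ^ 2)) : lp (fun _ : ℕ => ℝ) ∞ := lp.single ∞ i (1 : ℝ)
  have hfin : FiniteDimensional ℝ (span ℝ (Set.range e)) :=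
    FiniteDimensional.span_of_finite ℝ (Set.finite_range e)
  have herank : Module.finrank ℝ (span ℝ (Set.range e)) ≤ q ^ 2 :=
    (finrank_range_le_card e).trans_eq (Fintype.card_fin _)
  refine ⟨span ℝ (Set.range e) ⊔ Y, inferInstance,
    (finrank_add_le_finrank_add_finrank _ _).trans (by omega), fun j => ?_⟩
  rcases lt_or_ge j (q ^ 2) with hj2 | hj2
  · refine ⟨x j • lp.single ∞ j (1 : ℝ),
      mem_sup_left (smul_mem _ _ (subset_span ⟨⟨j, hj2⟩, rfl⟩)), ?_⟩
    rw [sub_self, norm_zero]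
    positivity
  rcases lt_or_ge j (q ^ 4) with hj4 | hj4
  · obtain ⟨y, hy, hyj⟩ := hYapp j hj4
    refine ⟨x j • y, mem_sup_right (smul_mem _ _ hy), ?_⟩
    have hxj : x j ≤ (q : ℝ) ^ (2 * -α) := by
      have := (hxle j (hj2.trans' (Nat.pow_pos hq.pos))).trans
        (rpow_neg_anti (by linarith) (Nat.pow_pos hq.pos) hj2)
      rw [Nat.cast_pow, hqpow] at this
      exact_mod_cast this
    rw [← smul_sub, norm_smul, Real.norm_of_nonneg (hx j)]
    calc x j * ‖lp.single ∞ j (1 : ℝ) - y‖ ≤ (q : ℝ) ^ (2 * -α) * ((4 : ℕ) / q) := by gcongr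
      _ = 4 * (q : ℝ) ^ ((2 : ℕ) * (-α - 1 / 2)) := by
        rw [show ((2 : ℕ) : ℝ) * (-α - 1 / 2) = 2 * -α + -1 by push_cast; ring,
          Real.rpow_add hq0, Real.rpow_neg_one]
        push_cast
        ring
      _ ≤ _ := by rw [mul_assoc]; gcongr
  · refine ⟨0, zero_mem _, ?_⟩
    rw [sub_zero, hnorm]
    have hxj : x j ≤ (q : ℝ) ^ (4 * -α) := by
      have := (hxle j (hj4.trans' (Nat.pow_pos hq.pos))).trans
        (rpow_neg_anti (by linarith) (Nat.pow_pos hq.pos) hj4)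
      rw [Nat.cast_pow, hqpow] at this
      exact_mod_cast this
    have hle : (q : ℝ) ^ (4 * -α) ≤ (q : ℝ) ^ ((2 : ℕ) * (-α - 1 / 2)) :=
      Real.rpow_le_rpow_of_exponent_le hq1 (by push_cast; linarith)
    have : 0 ≤ (8 : ℝ) ^ (α + 1 / 2) * (n : ℝ) ^ (-α - 1 / 2) := by positivity
    linarith

/-- If `f j` is supported at `j`, then the elements of the span of `f 0, …, f (n - 1)` vanish at
index `n`. -/
theorem apply_eq_zero_of_mem_span_image_Iio {x : ℕ → ℝ} {f : ℕ → lp (fun _ : ℕ => ℝ) ∞}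
    (hf : ∀ j, f j = x j • lp.single ∞ j (1 : ℝ)) {n : ℕ} {g : lp (fun _ : ℕ => ℝ) ∞}
    (hg : g ∈ span ℝ (f '' Set.Iio n)) : g n = 0 := by
  induction hg using span_induction with
  | mem g hg =>
    obtain ⟨j, hj, rfl⟩ := hg
    rw [hf, lp.coeFn_smul, Pi.smul_apply, lp.single_apply_ne _ _ _ (ne_of_gt hj), smul_zero]
  | zero => simp
  | add g h _ _ hg hh => rw [lp.coeFn_add, Pi.add_apply, hg, hh, add_zero]
  | smul c g _ hg => rw [lp.coeFn_smul, Pi.smul_apply, hg, smul_zero]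

/-- Section 5, second example: with `x_0 = 1` and `x_j = 2^{-kα}` for
`2^{k-1} ≤ j ≤ 2^k - 1` (`α > 1/2`), and `F = {x_j e_j : j ≥ 0} ∪ {0} ⊂ ℓ∞(ℕ)`,
the greedy errors satisfy `σ_n(F) = x_n ≥ (2n)^{-α}` while the Kolmogorov widths
satisfy `d_n(F) ≤ C n^{-α-1/2}`; hence the `√n` factor in the Banach-space bound
cannot in general be removed. -/
theorem greedy_linf_lower_bound_example
    (α : ℝ) (hα : 1 / 2 < α)
    (x : ℕ → ℝ) (hx0 : x 0 = 1)
    (hxk : ∀ k : ℕ, 1 ≤ k → ∀ j : ℕ, 2 ^ (k - 1) ≤ j → j ≤ 2 ^ k - 1 →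
      x j = (2 : ℝ) ^ (-(k : ℝ) * α))
    (f : ℕ → lp (fun _ : ℕ => ℝ) ∞)
    (hf : ∀ j, f j = x j • lp.single ∞ j (1 : ℝ))
    (F : Set (lp (fun _ : ℕ => ℝ) ∞)) (hF : F = Set.range f ∪ {0}) :
    (∀ n : ℕ, 1 ≤ n →
        sSup ((fun g => infDist g
            ((span ℝ (f '' Set.Iio n) : Submodule ℝ (lp (fun _ : ℕ => ℝ) ∞)) : Set _)) '' F)
          = x n ∧
        ((2 * n : ℕ) : ℝ) ^ (-α) ≤ x n) ∧
      ∃ C : ℝ, 0 < C ∧ ∀ n : ℕ, 1 ≤ n →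
        (⨅ Y : {Y : Submodule ℝ (lp (fun _ : ℕ => ℝ) ∞) //
            FiniteDimensional ℝ Y ∧ Module.finrank ℝ Y ≤ n},
          sSup ((fun g => infDist g ((Y : Submodule ℝ (lp (fun _ : ℕ => ℝ) ∞)) : Set _)) '' F))
          ≤ C * (n : ℝ) ^ (-α - 1 / 2) := by
  have hα0 : 0 ≤ α := by linarith
  subst hF
  have hx (j : ℕ) : 0 ≤ x j := by
    rcases Nat.eq_zero_or_pos j with rfl | hj
    · simp [hx0]
    · rw [dyadic_eq hxk hj]
      positivity
  have hanti {i j : ℕ} (hi : 1 ≤ i) (hij : i ≤ j) : x j ≤ x i := by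
    rw [dyadic_eq hxk hi, dyadic_eq hxk (hi.trans hij)]
    exact rpow_neg_anti hα0 Nat.one_le_two_pow
      (Nat.pow_le_pow_right two_pos (Nat.succ_le_succ (Nat.log_mono_right hij)))
  have hnorm (j : ℕ) : ‖f j‖ = x j := by
    rw [hf, norm_smul, lp.norm_single (by simp), norm_one, mul_one, Real.norm_of_nonneg (hx j)]
  refine ⟨fun n hn => ⟨?_, ?_⟩, 4 * 8 ^ (α + 1 / 2), by positivity, fun n hn => ?_⟩
  · refine IsGreatest.csSup_eq ⟨⟨_, Or.inl ⟨n, rfl⟩, ?_⟩, ?_⟩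
    · refine le_antisymm ?_ ((le_infDist (Submodule.nonempty _)).2 fun y hy => ?_)
      · refine (infDist_le_dist_of_mem (zero_mem _)).trans_eq ?_
        rw [dist_zero_right, hnorm]
      · have h := lp.norm_apply_le_norm top_ne_zero (f n - y) n
        rw [lp.coeFn_sub, Pi.sub_apply, apply_eq_zero_of_mem_span_image_Iio hf hy, sub_zero,
          hf, lp.coeFn_smul, Pi.smul_apply, lp.single_apply_self, smul_eq_mul, mul_one,
          Real.norm_of_nonneg (hx n)] at h
        rwa [dist_eq_norm, hf]
    · rintro _ ⟨_, ⟨j, rfl⟩ | rfl, rfl⟩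
      · rcases lt_or_ge j n with hj | hj
        · have hmem : f j ∈ span ℝ (f '' Set.Iio n) := subset_span ⟨j, hj, rfl⟩
          exact (infDist_zero_of_mem hmem).trans_le (hx n)
        · refine (infDist_le_dist_of_mem (zero_mem _)).trans ?_
          rw [dist_zero_right, hnorm]
          exact hanti hn hj
      · exact (infDist_zero_of_mem (zero_mem _)).trans_le (hx n)
  · rw [dyadic_eq hxk hn]
    refine rpow_neg_anti hα0 Nat.one_le_two_pow ?_
    rw [pow_succ']
    exact Nat.mul_le_mul_left 2 (Nat.pow_log_le_self 2 (by omega))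
  · have hxle (j : ℕ) (hj : 1 ≤ j) : x j ≤ (j : ℝ) ^ (-α) := by
      rw [dyadic_eq hxk hj]
      exact rpow_neg_anti hα0 hj (Nat.lt_pow_succ_log_self one_lt_two j).le
    obtain ⟨Y, hY, hrank, happ⟩ := exists_subspace_approx hα hx0 hx hxle hn
    refine (ciInf_le ⟨0, ?_⟩ ⟨Y, hY, hrank⟩).trans (Real.sSup_le ?_ (by positivity))
    · rintro _ ⟨Z, rfl⟩
      refine Real.sSup_nonneg ?_
      rintro _ ⟨g, -, rfl⟩
      exact infDist_nonneg
    · rintro _ ⟨_, ⟨j, rfl⟩ | rfl, rfl⟩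
      · obtain ⟨y, hy, hyj⟩ := happ j
        exact (infDist_le_dist_of_mem hy).trans (by rwa [dist_eq_norm, hf])
      · exact (infDist_zero_of_mem (zero_mem _)).trans_le (by positivity)
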